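/- arXiv:2008.06248 — 9 statements merged into one kernel-verified Lean document; each statement's English description precedes it below -/
import Mathlib

section
/- Let H, r, b, λ be positive integers with 0 < r, b < H, λ < min(r,b) and r + b ≤ H + λ. Index rows by the b-subsets B of [0,H) and columns by the r-subsets A of [0,H), and define the array P by p_{B,A} = ((A∪B)\(A∩B), A∩B) if |A∩B| = λ, and p_{B,A} = * otherwise. Then P is a placement delivery array with K = C(H,r) columns, F = C(H,b) rows, exactly Z = C(H,b) − C(r,λ)·C(H−r, b−λ) stars in each column, and exactly S = C(H, r+b−2λ)·C(H−r−b+2λ, λ) distinct non-star labels, each of which occurs at least once; moreover any two distinct entries carrying the same label lie in distinct rows and distinct columns and the two cross entries are stars (property C3). -/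
open Finset in
theorem aux_c1 (H r b l : ℕ) (hlb : l < b) (A : Finset (Fin H)) (hA : A.card = r) :
    ((Finset.powersetCard b (Finset.univ : Finset (Fin H))).filter
          fun B => (A ∩ B).card = l).card
        = Nat.choose r l * Nat.choose (H - r) (b - l) := by
  have h2 : (powersetCard l A ×ˢ powersetCard (b - l) Aᶜ).card
      = Nat.choose r l * Nat.choose (H - r) (b - l) := by
    rw [card_product, card_powersetCard, card_powersetCard, card_compl, hA, Fintype.card_fin]
  rw [← h2]
  refine Finset.card_bij' (fun B _ => (A ∩ B, B \ A)) (fun p _ => p.1 ∪ p.2) ?_ ?_ ?_ ?_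
  · intro B hB
    simp only [mem_filter, mem_powersetCard, subset_univ, true_and] at hB
    simp only [mem_product, mem_powersetCard]
    have h3 := card_sdiff_add_card_inter B A
    rw [inter_comm] at h3
    refine ⟨⟨inter_subset_left, hB.2⟩, ?_, by omega⟩
    intro x; simp
  · rintro ⟨I, J⟩ hp
    simp only [mem_product, mem_powersetCard] at hp
    obtain ⟨⟨hI, hIc⟩, hJ, hJc⟩ := hp
    have hd : Disjoint I J := by
      rw [disjoint_left]; intro x hx hx'
      have := hJ hx'
      simp at this
      exact this (hI hx)
    have he : A ∩ (I ∪ J) = I := by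
      ext x
      have h4 := @hI x
      have h5 := @hJ x
      simp at h5 ⊢; tauto
    simp only [mem_filter, mem_powersetCard, subset_univ, true_and]
    rw [he, card_union_of_disjoint hd]
    omega
  · intro B hB
    ext x; simp; tauto
  · rintro ⟨I, J⟩ hp
    simp only [mem_product, mem_powersetCard] at hp
    obtain ⟨⟨hI, hIc⟩, hJ, hJc⟩ := hp
    simp only [Prod.mk.injEq]
    constructor <;>
    · ext x
      have h4 := @hI x
      have h5 := @hJ x
      simp at h5 ⊢; tauto

open Finset in
theorem aux_c2 (H r b l : ℕ) (hlr : l < r) (hlb : l < b) :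
    ((((Finset.powersetCard b (Finset.univ : Finset (Fin H))) ×ˢ
        (Finset.powersetCard r (Finset.univ : Finset (Fin H)))).filter
          (fun p => (p.2 ∩ p.1).card = l)).image
          (fun p => ((p.2 ∪ p.1) \ (p.2 ∩ p.1), p.2 ∩ p.1))).card
      = Nat.choose H (r + b - 2 * l) * Nat.choose (H + 2 * l - (r + b)) l := by
  have h2 : ((powersetCard (r + b - 2 * l) (univ : Finset (Fin H))).sigma
      (fun D => powersetCard l Dᶜ)).card
      = Nat.choose H (r + b - 2 * l) * Nat.choose (H + 2 * l - (r + b)) l := by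
    rw [card_sigma, sum_congr rfl (g := fun _ => Nat.choose (H + 2 * l - (r + b)) l)]
    · simp
    · intro D hD
      rw [mem_powersetCard] at hD
      rw [card_powersetCard, card_compl, hD.2, Fintype.card_fin]
      congr 1; omega
  rw [← h2]
  refine Finset.card_bij' (fun p _ => ⟨p.1, p.2⟩) (fun p _ => (p.1, p.2)) ?_ ?_ ?_ ?_
  · rintro ⟨D, I⟩ hp
    simp only [mem_image, mem_filter, mem_product, mem_powersetCard, subset_univ, true_and,
      Prod.mk.injEq, Prod.exists] at hp
    obtain ⟨B, A, ⟨⟨hB, hA⟩, hc⟩, rfl, rfl⟩ := hp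
    simp only [mem_sigma, mem_powersetCard, subset_univ, true_and]
    refine ⟨?_, ?_, hc⟩
    · have h3 := card_union_add_card_inter A B
      have h4 := card_sdiff_add_card_eq_card
        (show A ∩ B ⊆ A ∪ B from inter_subset_left.trans subset_union_left)
      omega
    · intro x; simp; tauto
  · rintro ⟨D, I⟩ hp
    simp only [mem_sigma, mem_powersetCard, subset_univ, true_and] at hp
    obtain ⟨hD, hI, hIc⟩ := hp
    obtain ⟨A', hA', hAc⟩ := exists_subset_card_eq (show r - l ≤ D.card by omega)
    have hx : ∀ x, (x ∈ I → x ∉ D) ∧ (x ∈ A' → x ∈ D) := by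
      intro x
      have h5 := @hI x
      simp at h5
      exact ⟨h5, @hA' x⟩
    have hd1 : Disjoint A' I := by
      rw [disjoint_left]; intro x; have := hx x; tauto
    have hd2 : Disjoint (D \ A') I := by
      rw [disjoint_left]; intro x; have := hx x; simp; tauto
    have hi : (A' ∪ I) ∩ (D \ A' ∪ I) = I := by
      ext x; have := hx x; simp; tauto
    simp only [mem_image, mem_filter, mem_product, mem_powersetCard, subset_univ, true_and,
      Prod.mk.injEq, Prod.exists]
    refine ⟨D \ A' ∪ I, A' ∪ I, ⟨⟨?_, ?_⟩, ?_⟩, ?_, hi⟩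
    · have := card_sdiff_add_card_eq_card hA'
      rw [card_union_of_disjoint hd2]; omega
    · rw [card_union_of_disjoint hd1]; omega
    · rw [hi, hIc]
    · rw [hi]; ext x; have := hx x; simp; tauto
  · intros; rfl
  · intros; rfl

open Finset in
theorem aux_c3 {α : Type*} [DecidableEq α] (A₁ B₁ A₂ B₂ : Finset α)
    (hD : (A₁ ∪ B₁) \ (A₁ ∩ B₁) = (A₂ ∪ B₂) \ (A₂ ∩ B₂)) (hI : A₁ ∩ B₁ = A₂ ∩ B₂) :
    (B₁ = B₂ ↔ A₁ = A₂) ∧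
    (B₁.card = B₂.card → (A₁ ∩ B₂).card = (A₁ ∩ B₁).card → B₁ = B₂) := by
  have hx : ∀ x, ((x ∈ A₁ ∧ x ∈ B₁) ↔ (x ∈ A₂ ∧ x ∈ B₂)) ∧
      ((x ∈ A₁ ∨ x ∈ B₁) ↔ (x ∈ A₂ ∨ x ∈ B₂)) := by
    intro x
    have h1 := Finset.ext_iff.1 hD x
    have h2 := Finset.ext_iff.1 hI x
    simp only [mem_sdiff, mem_union, mem_inter] at h1 h2
    tauto
  refine ⟨⟨?_, ?_⟩, ?_⟩
  · rintro rfl; ext x; have := hx x; tauto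
  · rintro rfl; ext x; have := hx x; tauto
  · intro hB hc
    have h1 : A₁ ∩ B₁ = A₁ ∩ B₂ := by
      apply eq_of_subset_of_card_le _ hc.le
      intro x; have := hx x; simp only [mem_inter]; tauto
    have h2 : A₁ ∪ B₂ = A₁ ∪ B₁ := by
      apply eq_of_subset_of_card_le
      · intro x; have := hx x; simp only [mem_union]; tauto
      · have h3 := card_union_add_card_inter A₁ B₁
        have h4 := card_union_add_card_inter A₁ B₂
        omega
    ext x
    have h5 := Finset.ext_iff.1 h1 x
    have h6 := Finset.ext_iff.1 h2 x
    simp only [mem_union, mem_inter] at h5 h6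
    tauto

/-- The array `P` indexed by rows `B` (the `b`-subsets of `[0,H)`) and columns
`A` (the `r`-subsets of `[0,H)`), with `p_{B,A} = ((A∪B)\(A∩B), A∩B)` if `|A∩B| = λ` and
`p_{B,A} = *` otherwise, is a placement delivery array: (C1) each column has exactly
`C(H,b) − C(r,λ)·C(H−r,b−λ)` stars; (C2) there are exactly
`C(H, r+b−2λ)·C(H−r−b+2λ, λ)` distinct non-star labels (each occurring at least once,
being elements of the image); (C3) two distinct entries with the same label lie in distinct
rows and distinct columns, and both cross entries are stars. -/
theorem stmt_3 (H r b l : ℕ) (hH : 0 < H) (hr : 0 < r) (hb : 0 < b) (hl : 0 < l)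
    (hrH : r < H) (hbH : b < H) (hlr : l < r) (hlb : l < b) (hrb : r + b ≤ H + l) :
    -- C1: exactly Z stars in each column
    (∀ A ∈ Finset.powersetCard r (Finset.univ : Finset (Fin H)),
      ((Finset.powersetCard b (Finset.univ : Finset (Fin H))).filter
          fun B => (A ∩ B).card ≠ l).card
        = Nat.choose H b - Nat.choose r l * Nat.choose (H - r) (b - l)) ∧
    -- C2: exactly S distinct non-star labels, each occurring at least once
    ((((Finset.powersetCard b (Finset.univ : Finset (Fin H))) ×ˢ
        (Finset.powersetCard r (Finset.univ : Finset (Fin H)))).filter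
          (fun p => (p.2 ∩ p.1).card = l)).image
          (fun p => ((p.2 ∪ p.1) \ (p.2 ∩ p.1), p.2 ∩ p.1))).card
      = Nat.choose H (r + b - 2 * l) * Nat.choose (H + 2 * l - (r + b)) l ∧
    -- C3
    (∀ B₁ A₁ B₂ A₂ : Finset (Fin H),
      B₁.card = b → A₁.card = r → B₂.card = b → A₂.card = r →
      (A₁ ∩ B₁).card = l → (A₂ ∩ B₂).card = l → (B₁, A₁) ≠ (B₂, A₂) →
      ((A₁ ∪ B₁) \ (A₁ ∩ B₁), A₁ ∩ B₁) = ((A₂ ∪ B₂) \ (A₂ ∩ B₂), A₂ ∩ B₂) →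
      B₁ ≠ B₂ ∧ A₁ ≠ A₂ ∧ (A₁ ∩ B₂).card ≠ l ∧ (A₂ ∩ B₁).card ≠ l) := by
  refine ⟨?_, aux_c2 H r b l hlr hlb, ?_⟩
  · intro A hA
    rw [Finset.mem_powersetCard] at hA
    have h1 := aux_c1 H r b l hlb A hA.2
    have h2 := Finset.card_filter_add_card_filter_not
      (s := Finset.powersetCard b (Finset.univ : Finset (Fin H))) (fun B => (A ∩ B).card = l)
    rw [Finset.card_powersetCard, Finset.card_univ, Fintype.card_fin, h1] at h2
    simp only [ne_eq]
    omega
  · intro B₁ A₁ B₂ A₂ hB₁ hA₁ hB₂ hA₂ h1 h2 hne heq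
    rw [Prod.mk.injEq] at heq
    have k1 := aux_c3 A₁ B₁ A₂ B₂ heq.1 heq.2
    have k2 := aux_c3 A₂ B₂ A₁ B₁ heq.1.symm heq.2.symm
    have hn : B₁ ≠ B₂ := fun h => hne (by rw [h, k1.1.1 h])
    refine ⟨hn, fun h => hn (k1.1.2 h), fun h => hn (k1.2 (by omega) (by omega)),
      fun h => hn (k2.2 (by omega) (by omega)).symm⟩
end

section
/- Let H, r, b, λ be positive integers with 0 < r, b < H, λ < min(r,b) and r + b ≤ H + λ. Let A1, A2 be r-subsets and B1, B2 be b-subsets of [0,H) with |A1∩B1| = |A2∩B2| = λ, (B1,A1) ≠ (B2,A2), and suppose (A1∪B1)\(A1∩B1) = (A2∪B2)\(A2∩B2) and A1∩B1 = A2∩B2. Then A1 ≠ A2, B1 ≠ B2, |A1∩B2| ≠ λ and |A2∩B1| ≠ λ. -/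
/-- Verification of PDA property C3 for the array `P` with labels
`((A∪B)\(A∩B), A∩B)`: two distinct entries carrying the same label lie in distinct rows and
distinct columns, and the cross entries are stars (`|A₁∩B₂| ≠ λ` and `|A₂∩B₁| ≠ λ`). -/
theorem stmt_5 (H r b l : ℕ) (hH : 0 < H) (hr : 0 < r) (hb : 0 < b) (hl : 0 < l)
    (hrH : r < H) (hbH : b < H) (hlr : l < r) (hlb : l < b) (hrb : r + b ≤ H + l)
    (A₁ A₂ B₁ B₂ : Finset (Fin H))
    (hA₁ : A₁.card = r) (hA₂ : A₂.card = r) (hB₁ : B₁.card = b) (hB₂ : B₂.card = b)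
    (h₁ : (A₁ ∩ B₁).card = l) (h₂ : (A₂ ∩ B₂).card = l)
    (hne : (B₁, A₁) ≠ (B₂, A₂))
    (hC : (A₁ ∪ B₁) \ (A₁ ∩ B₁) = (A₂ ∪ B₂) \ (A₂ ∩ B₂))
    (hI : A₁ ∩ B₁ = A₂ ∩ B₂) :
    A₁ ≠ A₂ ∧ B₁ ≠ B₂ ∧ (A₁ ∩ B₂).card ≠ l ∧ (A₂ ∩ B₁).card ≠ l := by
  have HI : ∀ x, (x ∈ A₁ ∧ x ∈ B₁) ↔ (x ∈ A₂ ∧ x ∈ B₂) := fun x => by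
    simpa using Finset.ext_iff.mp hI x
  have HC : ∀ x, ((x ∈ A₁ ∨ x ∈ B₁) ∧ ¬ (x ∈ A₁ ∧ x ∈ B₁)) ↔
      ((x ∈ A₂ ∨ x ∈ B₂) ∧ ¬ (x ∈ A₂ ∧ x ∈ B₂)) := fun x => by
    have := Finset.ext_iff.mp hC x
    simpa only [Finset.mem_sdiff, Finset.mem_union, Finset.mem_inter] using this
  have hA : A₁ ≠ A₂ := by
    intro h
    subst h
    apply hne
    have : B₁ = B₂ := by
      ext x
      have := HI x
      have := HC x
      grind
    rw [this]
  have hB : B₁ ≠ B₂ := by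
    intro h
    subst h
    apply hA
    ext x
    have := HI x
    have := HC x
    grind
  refine ⟨hA, hB, ?_, ?_⟩
  · intro h
    have hsub : A₁ ∩ B₁ ⊆ A₁ ∩ B₂ := by
      intro x hx
      have := HI x
      simp only [Finset.mem_inter] at hx ⊢
      grind
    have he := Finset.eq_of_subset_of_card_le hsub (by omega)
    apply hA
    refine Finset.eq_of_subset_of_card_le (fun x hx => ?_) (by omega)
    have h3 := Finset.ext_iff.mp he x
    simp only [Finset.mem_inter] at h3
    have := HI x
    have := HC x
    grind
  · intro h
    have hsub : A₂ ∩ B₂ ⊆ A₂ ∩ B₁ := by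
      intro x hx
      have := HI x
      simp only [Finset.mem_inter] at hx ⊢
      grind
    have he := Finset.eq_of_subset_of_card_le hsub (by omega)
    apply hA
    symm
    refine Finset.eq_of_subset_of_card_le (fun x hx => ?_) (by omega)
    have h3 := Finset.ext_iff.mp he x
    simp only [Finset.mem_inter] at h3
    have := HI x
    have := HC x
    grind
end

section
/- Let H, r, b, λ be positive integers with 0 < r, b < H, λ < min(r,b) and r + b ≤ H + λ. Let A1, A2 be r-subsets and B1, B2 be b-subsets of [0,H) with |A1∩B1| = |A2∩B2| = λ, (B1,A1) ≠ (B2,A2), and suppose (A1∪B1)\(A1∩B1) = (A2∪B2)\(A2∩B2) and A1\B1 = A2\B2. Then A1 ≠ A2, B1 ≠ B2, |A1∩B2| ≠ λ and |A2∩B1| ≠ λ. -/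
/-- Verification of PDA property C3 for the array `P'` with labels
`((A∪B)\(A∩B), A\B)`: two distinct entries carrying the same label lie in distinct rows and
distinct columns, and the cross entries are stars (`|A₁∩B₂| ≠ λ` and `|A₂∩B₁| ≠ λ`). -/
theorem stmt_6 (H r b l : ℕ) (hH : 0 < H) (hr : 0 < r) (hb : 0 < b) (hl : 0 < l)
    (hrH : r < H) (hbH : b < H) (hlr : l < r) (hlb : l < b) (hrb : r + b ≤ H + l)
    (A₁ A₂ B₁ B₂ : Finset (Fin H))
    (hA₁ : A₁.card = r) (hA₂ : A₂.card = r) (hB₁ : B₁.card = b) (hB₂ : B₂.card = b)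
    (h₁ : (A₁ ∩ B₁).card = l) (h₂ : (A₂ ∩ B₂).card = l)
    (hne : (B₁, A₁) ≠ (B₂, A₂))
    (hC : (A₁ ∪ B₁) \ (A₁ ∩ B₁) = (A₂ ∪ B₂) \ (A₂ ∩ B₂))
    (hD : A₁ \ B₁ = A₂ \ B₂) :
    A₁ ≠ A₂ ∧ B₁ ≠ B₂ ∧ (A₁ ∩ B₂).card ≠ l ∧ (A₂ ∩ B₁).card ≠ l := by
  have hC' : ∀ x, ((x ∈ A₁ ∨ x ∈ B₁) ∧ ¬(x ∈ A₁ ∧ x ∈ B₁)) ↔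
      ((x ∈ A₂ ∨ x ∈ B₂) ∧ ¬(x ∈ A₂ ∧ x ∈ B₂)) := by
    intro x
    have := Finset.ext_iff.mp hC x
    simpa only [Finset.mem_sdiff, Finset.mem_union, Finset.mem_inter] using this
  have hD' : ∀ x, (x ∈ A₁ ∧ x ∉ B₁) ↔ (x ∈ A₂ ∧ x ∉ B₂) := by
    intro x
    have := Finset.ext_iff.mp hD x
    simpa only [Finset.mem_sdiff] using this
  have key : ¬ ∀ x, (x ∈ A₁ ∧ x ∈ B₁) ↔ (x ∈ A₂ ∧ x ∈ B₂) := by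
    intro h
    apply hne
    rw [Prod.mk.injEq]
    constructor
    · ext x
      have := h x; have := hC' x; have := hD' x
      grind only
    · ext x
      have := h x; have := hC' x; have := hD' x
      grind only
  -- a set of size `l` contained in both intersections forces them to be equal
  have key2 : ∀ S : Finset (Fin H), S ⊆ A₁ ∩ B₁ → S ⊆ A₂ ∩ B₂ → S.card ≠ l := by
    intro S hS₁ hS₂ hS
    have e₁ := Finset.eq_of_subset_of_card_le hS₁ (by omega)
    have e₂ := Finset.eq_of_subset_of_card_le hS₂ (by omega)
    apply key
    intro x
    rw [← Finset.mem_inter, ← Finset.mem_inter, ← e₁, ← e₂]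
  refine ⟨?_, ?_, ?_, ?_⟩
  · intro h
    subst h
    apply key
    intro x
    have := hD' x
    grind only
  · intro h
    subst h
    apply key
    intro x
    have := hC' x; have := hD' x
    grind only
  all_goals
    apply key2
    all_goals
      intro x hx
      rw [Finset.mem_inter] at hx ⊢
      have := hC' x; have := hD' x
      grind only
end

section
/- Let H, r, b, λ be positive integers with 0 < r, b < H, λ < min(r,b) and r + b ≤ H + λ. The set of pairs ((A∪B)\(A∩B), A∩B), taken over all r-subsets A and b-subsets B of [0,H) with |A∩B| = λ, is exactly the set of pairs (C, I) where C is an (r+b−2λ)-subset of [0,H), I is a λ-subset of [0,H), and C ∩ I = ∅; in particular this set has cardinality C(H, r+b−2λ)·C(H−(r+b−2λ), λ). -/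
theorem label_set_eq (H r b l : ℕ) (hlr : l < r) (hlb : l < b) :
    ((((Finset.powersetCard r (Finset.univ : Finset (Fin H))) ×ˢ
        (Finset.powersetCard b (Finset.univ : Finset (Fin H)))).filter
          (fun p => (p.1 ∩ p.2).card = l)).image
          (fun p => ((p.1 ∪ p.2) \ (p.1 ∩ p.2), p.1 ∩ p.2)))
      = ((Finset.powersetCard (r + b - 2 * l) (Finset.univ : Finset (Fin H))) ×ˢ
          (Finset.powersetCard l (Finset.univ : Finset (Fin H)))).filter
            (fun q => q.1 ∩ q.2 = ∅) := by
  ext ⟨C, I⟩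
  simp only [Finset.mem_image, Finset.mem_filter, Finset.mem_product, Finset.mem_powersetCard,
    Finset.subset_univ, true_and, Prod.mk.injEq, Prod.exists]
  constructor
  · rintro ⟨A, B, ⟨⟨hA, hB⟩, hAB⟩, rfl, rfl⟩
    refine ⟨⟨?_, hAB⟩, Finset.sdiff_inter_self _ _⟩
    have h1 := Finset.card_union_add_card_inter A B
    have h2 : ((A ∪ B) \ (A ∩ B)).card = (A ∪ B).card - (A ∩ B).card :=
      Finset.card_sdiff_of_subset (Finset.inter_subset_left.trans Finset.subset_union_left)
    omega
  · rintro ⟨⟨hC, hI⟩, hCI⟩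
    obtain ⟨D, hDC, hD⟩ := Finset.exists_subset_card_eq (s := C) (n := r - l) (by omega)
    have hdis : ∀ x, x ∈ C → x ∉ I := fun x h1 h2 => by
      have : x ∈ C ∩ I := Finset.mem_inter.2 ⟨h1, h2⟩
      simp [hCI] at this
    have hint : (D ∪ I) ∩ ((C \ D) ∪ I) = I := by
      ext x
      simp only [Finset.mem_inter, Finset.mem_union, Finset.mem_sdiff]
      tauto
    refine ⟨D ∪ I, (C \ D) ∪ I, ⟨⟨?_, ?_⟩, ?_⟩, ?_, hint⟩
    · rw [Finset.card_union_of_disjoint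
        (Finset.disjoint_left.2 fun x hx => hdis x (hDC hx))]
      omega
    · rw [Finset.card_union_of_disjoint
        (Finset.disjoint_left.2 fun x hx => hdis x (Finset.mem_sdiff.1 hx).1),
        Finset.card_sdiff_of_subset hDC]
      omega
    · rw [hint, hI]
    · rw [hint]
      ext x
      have h1 := hdis x
      have h2 := @hDC x
      simp only [Finset.mem_union, Finset.mem_sdiff]
      tauto

theorem disjoint_pairs_card (H k l : ℕ) :
    (((Finset.powersetCard k (Finset.univ : Finset (Fin H))) ×ˢ
          (Finset.powersetCard l (Finset.univ : Finset (Fin H)))).filter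
            (fun q => q.1 ∩ q.2 = ∅)).card = Nat.choose H k * Nat.choose (H - k) l := by
  have h : (((Finset.powersetCard k (Finset.univ : Finset (Fin H))) ×ˢ
          (Finset.powersetCard l (Finset.univ : Finset (Fin H)))).filter
            (fun q => q.1 ∩ q.2 = ∅)).card =
      ((Finset.powersetCard k (Finset.univ : Finset (Fin H))).sigma
        (fun C => Finset.powersetCard l Cᶜ)).card := by
    refine Finset.card_bij' (fun q _ => ⟨q.1, q.2⟩) (fun q _ => (q.1, q.2)) ?_ ?_ ?_ ?_
    · rintro ⟨C, I⟩ hq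
      simp only [Finset.mem_filter, Finset.mem_product, Finset.mem_powersetCard,
        Finset.subset_univ, true_and, Finset.mem_sigma] at hq ⊢
      exact ⟨hq.1.1, Finset.subset_compl_iff_disjoint_left.2
        (Finset.disjoint_iff_inter_eq_empty.2 hq.2), hq.1.2⟩
    · rintro ⟨C, I⟩ hq
      simp only [Finset.mem_filter, Finset.mem_product, Finset.mem_powersetCard,
        Finset.subset_univ, true_and, Finset.mem_sigma] at hq ⊢
      exact ⟨⟨hq.1, hq.2.2⟩, Finset.disjoint_iff_inter_eq_empty.1
        (Finset.subset_compl_iff_disjoint_left.1 hq.2.1)⟩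
    · intros; rfl
    · intros; rfl
  rw [h, Finset.card_sigma, Finset.sum_const_nat (m := Nat.choose (H - k) l)]
  · simp
  · intro C hC
    rw [Finset.card_powersetCard, Finset.card_compl, (Finset.mem_powersetCard.1 hC).2,
      Fintype.card_fin]

/-- The set of labels `((A∪B)\(A∩B), A∩B)`, over all `r`-subsets `A` and
`b`-subsets `B` of `[0,H)` with `|A∩B| = λ`, is exactly the set of pairs `(C, I)` with `C`
an `(r+b−2λ)`-subset of `[0,H)`, `I` a `λ`-subset of `[0,H)`, and `C ∩ I = ∅`; in particular
it has cardinality `C(H, r+b−2λ)·C(H−(r+b−2λ), λ)`. -/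
theorem stmt_7 (H r b l : ℕ) (hH : 0 < H) (hr : 0 < r) (hb : 0 < b) (hl : 0 < l)
    (hrH : r < H) (hbH : b < H) (hlr : l < r) (hlb : l < b) (hrb : r + b ≤ H + l) :
    ((((Finset.powersetCard r (Finset.univ : Finset (Fin H))) ×ˢ
        (Finset.powersetCard b (Finset.univ : Finset (Fin H)))).filter
          (fun p => (p.1 ∩ p.2).card = l)).image
          (fun p => ((p.1 ∪ p.2) \ (p.1 ∩ p.2), p.1 ∩ p.2)))
      = ((Finset.powersetCard (r + b - 2 * l) (Finset.univ : Finset (Fin H))) ×ˢ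
          (Finset.powersetCard l (Finset.univ : Finset (Fin H)))).filter
            (fun q => q.1 ∩ q.2 = ∅) ∧
    ((((Finset.powersetCard r (Finset.univ : Finset (Fin H))) ×ˢ
        (Finset.powersetCard b (Finset.univ : Finset (Fin H)))).filter
          (fun p => (p.1 ∩ p.2).card = l)).image
          (fun p => ((p.1 ∪ p.2) \ (p.1 ∩ p.2), p.1 ∩ p.2))).card
      = Nat.choose H (r + b - 2 * l) * Nat.choose (H - (r + b - 2 * l)) l := by
  rw [label_set_eq H r b l hlr hlb]
  exact ⟨rfl, disjoint_pairs_card H _ l⟩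
end

section
/- Let H, r, b, λ be positive integers with 0 < r, b < H, λ < min(r,b) and r + b ≤ H + λ. The set of pairs ((A∪B)\(A∩B), A\B), taken over all r-subsets A and b-subsets B of [0,H) with |A∩B| = λ, is exactly the set of pairs (C, D) where C is an (r+b−2λ)-subset of [0,H) and D is an (r−λ)-subset of C; in particular this set has cardinality C(H, r+b−2λ)·C(r+b−2λ, r−λ). -/
theorem label_image_eq (H r b l : ℕ) (hlr : l < r) (hlb : l < b) (hrb : r + b ≤ H + l) :
    ((((Finset.powersetCard r (Finset.univ : Finset (Fin H))) ×ˢ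
        (Finset.powersetCard b (Finset.univ : Finset (Fin H)))).filter
          (fun p => (p.1 ∩ p.2).card = l)).image
          (fun p => ((p.1 ∪ p.2) \ (p.1 ∩ p.2), p.1 \ p.2)))
      = ((Finset.powersetCard (r + b - 2 * l) (Finset.univ : Finset (Fin H))) ×ˢ
          (Finset.powersetCard (r - l) (Finset.univ : Finset (Fin H)))).filter
            (fun q => q.2 ⊆ q.1) := by
  ext ⟨C, D⟩
  simp only [Finset.mem_image, Finset.mem_filter, Finset.mem_product, Finset.mem_powersetCard,
    Finset.subset_univ, true_and, Prod.mk.injEq, Prod.exists]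
  constructor
  · rintro ⟨A, B, ⟨⟨hA, hB⟩, hAB⟩, rfl, rfl⟩
    have h1 := Finset.card_union_add_card_inter A B
    have h2 : ((A ∪ B) \ (A ∩ B)).card + (A ∩ B).card = (A ∪ B).card :=
      Finset.card_sdiff_add_card_eq_card
        (Finset.inter_subset_left.trans Finset.subset_union_left)
    have h3 := Finset.card_sdiff_add_card_inter A B
    refine ⟨⟨by omega, by omega⟩, ?_⟩
    intro x hx
    simp only [Finset.mem_sdiff, Finset.mem_union, Finset.mem_inter] at hx ⊢
    tauto
  · rintro ⟨⟨hC, hD⟩, hDC⟩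
    have hc : l ≤ (Cᶜ).card := by
      rw [Finset.card_compl, Fintype.card_fin]
      omega
    obtain ⟨L, hL, hLc⟩ := Finset.exists_subset_card_eq hc
    have hLC : ∀ x, x ∈ L → x ∉ C := fun x hx => Finset.mem_compl.1 (hL hx)
    have hd1 : Disjoint D L := Finset.disjoint_left.2 fun x hx hx' => hLC x hx' (hDC hx)
    have hd2 : Disjoint (C \ D) L :=
      Finset.disjoint_left.2 fun x hx hx' => hLC x hx' (Finset.mem_sdiff.1 hx).1
    have hs := Finset.card_sdiff_add_card_eq_card hDC
    have hi : (D ∪ L) ∩ ((C \ D) ∪ L) = L := by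
      ext x
      simp only [Finset.mem_sdiff, Finset.mem_union, Finset.mem_inter]
      tauto
    refine ⟨D ∪ L, (C \ D) ∪ L, ⟨⟨?_, ?_⟩, ?_⟩, ?_, ?_⟩
    · rw [Finset.card_union_of_disjoint hd1]; omega
    · rw [Finset.card_union_of_disjoint hd2]; omega
    · rw [hi, hLc]
    · rw [hi]
      ext x
      have := hLC x
      have := @hDC x
      simp only [Finset.mem_sdiff, Finset.mem_union]
      tauto
    · ext x
      have := hLC x
      have := @hDC x
      simp only [Finset.mem_sdiff, Finset.mem_union]
      tauto

theorem label_card (H m k : ℕ) :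
    (((Finset.powersetCard m (Finset.univ : Finset (Fin H))) ×ˢ
          (Finset.powersetCard k (Finset.univ : Finset (Fin H)))).filter
            (fun q => q.2 ⊆ q.1)).card = Nat.choose H m * Nat.choose m k := by
  rw [Finset.card_filter, Finset.sum_product]
  have : ∀ C ∈ Finset.powersetCard m (Finset.univ : Finset (Fin H)),
      (∑ D ∈ Finset.powersetCard k (Finset.univ : Finset (Fin H)),
        if D ⊆ C then 1 else 0) = Nat.choose m k := by
    intro C hC
    rw [← Finset.card_filter, ← (Finset.mem_powersetCard.1 hC).2, ← Finset.card_powersetCard]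
    congr 1
    ext D
    simp [Finset.mem_powersetCard, and_comm]
  rw [Finset.sum_congr rfl this]
  simp

/-- The set of labels `((A∪B)\(A∩B), A\B)`, over all `r`-subsets `A` and
`b`-subsets `B` of `[0,H)` with `|A∩B| = λ`, is exactly the set of pairs `(C, D)` with `C`
an `(r+b−2λ)`-subset of `[0,H)` and `D` an `(r−λ)`-subset of `C`; in particular it has
cardinality `C(H, r+b−2λ)·C(r+b−2λ, r−λ)`. -/
theorem stmt_8 (H r b l : ℕ) (hH : 0 < H) (hr : 0 < r) (hb : 0 < b) (hl : 0 < l)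
    (hrH : r < H) (hbH : b < H) (hlr : l < r) (hlb : l < b) (hrb : r + b ≤ H + l) :
    ((((Finset.powersetCard r (Finset.univ : Finset (Fin H))) ×ˢ
        (Finset.powersetCard b (Finset.univ : Finset (Fin H)))).filter
          (fun p => (p.1 ∩ p.2).card = l)).image
          (fun p => ((p.1 ∪ p.2) \ (p.1 ∩ p.2), p.1 \ p.2)))
      = ((Finset.powersetCard (r + b - 2 * l) (Finset.univ : Finset (Fin H))) ×ˢ
          (Finset.powersetCard (r - l) (Finset.univ : Finset (Fin H)))).filter
            (fun q => q.2 ⊆ q.1) ∧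
    ((((Finset.powersetCard r (Finset.univ : Finset (Fin H))) ×ˢ
        (Finset.powersetCard b (Finset.univ : Finset (Fin H)))).filter
          (fun p => (p.1 ∩ p.2).card = l)).image
          (fun p => ((p.1 ∪ p.2) \ (p.1 ∩ p.2), p.1 \ p.2))).card
      = Nat.choose H (r + b - 2 * l) * Nat.choose (r + b - 2 * l) (r - l) := by
  have h := label_image_eq H r b l hlr hlb hrb
  refine ⟨h, ?_⟩
  rw [h, label_card]
end

section
/- Let H, r, b, λ be positive integers with 0 < r, b < H, λ < min(r,b) and r + b ≤ H + λ. Let A be an r-subset and B a b-subset of [0,H) with |A∩B| > λ. Then there exist an r-subset A' ≠ A and a b-subset B' ≠ B of [0,H) such that |A∩B'| = λ, |A'∩B| = λ, A∩B' = A'∩B, and (A∪B')\(A∩B') = (A'∪B)\(A'∩B). (Hence the star entry p_{B,A} of the array P is useful.) -/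
/-- If `|A∩B| > λ` (so `p_{B,A} = *` in the array `P` with labels
`((A∪B)\(A∩B), A∩B)`), then there exist entries `p_{B',A}` and `p_{B,A'}` (with `A' ≠ A`,
`B' ≠ B`) carrying the same non-star label; hence the star `p_{B,A}` is useful. -/
theorem stmt_10 (H r b l : ℕ) (hH : 0 < H) (hr : 0 < r) (hb : 0 < b) (hl : 0 < l)
    (hrH : r < H) (hbH : b < H) (hlr : l < r) (hlb : l < b) (hrb : r + b ≤ H + l)
    (A B : Finset (Fin H)) (hA : A.card = r) (hB : B.card = b) (hAB : l < (A ∩ B).card) :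
    ∃ A' B' : Finset (Fin H), A' ≠ A ∧ B' ≠ B ∧ A'.card = r ∧ B'.card = b ∧
      (A ∩ B').card = l ∧ (A' ∩ B).card = l ∧ A ∩ B' = A' ∩ B ∧
      (A ∪ B') \ (A ∩ B') = (A' ∪ B) \ (A' ∩ B) := by
  have hun := Finset.card_union_add_card_inter A B
  obtain ⟨L, hL, hLc⟩ := Finset.exists_subset_card_eq hAB.le
  obtain ⟨U, hU, -, hUc⟩ := Finset.exists_subsuperset_card_eq
    (Finset.subset_univ (A ∪ B)) (n := r + b - l) (by omega)
    (by rw [Finset.card_univ, Fintype.card_fin]; omega)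
  have hLA : L ⊆ A := hL.trans Finset.inter_subset_left
  have hLB : L ⊆ B := hL.trans Finset.inter_subset_right
  have hUA : A ⊆ U := Finset.subset_union_left.trans hU
  have hUB : B ⊆ U := Finset.subset_union_right.trans hU
  have h1 : A ∩ (L ∪ U \ A) = L := by
    ext x; have := @hLA x; simp only [Finset.mem_inter, Finset.mem_union, Finset.mem_sdiff]; tauto
  have h2 : (L ∪ U \ B) ∩ B = L := by
    ext x; have := @hLB x; simp only [Finset.mem_inter, Finset.mem_union, Finset.mem_sdiff]; tauto
  have h3 : A ∪ (L ∪ U \ A) = U := by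
    ext x; have := @hLA x; have := @hUA x
    simp only [Finset.mem_union, Finset.mem_sdiff]; tauto
  have h4 : (L ∪ U \ B) ∪ B = U := by
    ext x; have := @hLB x; have := @hUB x
    simp only [Finset.mem_union, Finset.mem_sdiff]; tauto
  have h5 := Finset.card_union_add_card_inter A (L ∪ U \ A)
  have h6 := Finset.card_union_add_card_inter (L ∪ U \ B) B
  rw [h1, h3] at h5
  rw [h2, h4] at h6
  refine ⟨L ∪ U \ B, L ∪ U \ A, ?_, ?_, by omega, by omega, by rw [h1, hLc], by rw [h2, hLc],
    by rw [h1, h2], by rw [h1, h2, h3, h4]⟩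
  · intro h
    rw [h] at h2
    rw [h2] at hAB
    omega
  · intro h
    rw [h] at h1
    rw [h1] at hAB
    omega
end

section
/- Let H, r, b, λ be positive integers with 0 < r, b < H, λ < min(r,b) and r + b ≤ H. In the array P, for every fixed column A (an r-subset of [0,H)), the number of rows B (b-subsets of [0,H)) such that p_{B,A} = * is a useless star equals Σ_{i=0}^{λ−1} C(r,i)·C(H−r, b−i); equivalently, the useless stars in column A are exactly the entries p_{B,A} with |A∩B| < λ. -/
/-- A star entry `p_{B,A} = *` of the array `P` (with labels `((A∪B)\(A∩B), A∩B)` at entries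
with `|A∩B| = λ`) is *useful* if there exist entries `p_{B',A}` and `p_{B,A'}`
(with `B' ≠ B`, `A' ≠ A`) carrying the same non-star label. -/
def UsefulStarP (H r b l : ℕ) (B A : Finset (Fin H)) : Prop :=
  ∃ A' B' : Finset (Fin H), A' ≠ A ∧ B' ≠ B ∧ A'.card = r ∧ B'.card = b ∧
    (A ∩ B').card = l ∧ (A' ∩ B).card = l ∧
    ((A ∪ B') \ (A ∩ B'), A ∩ B') = ((A' ∪ B) \ (A' ∩ B), A' ∩ B)

theorem aux_useful (H r b l : ℕ) (hrb : r + b ≤ H) (A B : Finset (Fin H))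
    (hA : A.card = r) (hB : B.card = b) (h : l < (A ∩ B).card) : UsefulStarP H r b l B A := by
  obtain ⟨I, hI, hIc⟩ := Finset.exists_subset_card_eq h.le
  have hU := Finset.card_union_add_card_inter A B
  obtain ⟨U, hU1, hU2, hUc⟩ := Finset.exists_subsuperset_card_eq
    (s := A ∪ B) (t := Finset.univ) (n := r + b - l) (Finset.subset_univ _) (by omega)
    (by rw [Finset.card_univ, Fintype.card_fin]; omega)
  have hmA : (A ∩ B).card ≤ A.card := Finset.card_le_card Finset.inter_subset_left
  have hmB : (A ∩ B).card ≤ B.card := Finset.card_le_card Finset.inter_subset_right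
  have hAU : A ⊆ U := fun x hx => hU1 (Finset.mem_union_left _ hx)
  have hBU : B ⊆ U := fun x hx => hU1 (Finset.mem_union_right _ hx)
  have hIA : I ⊆ A := fun x hx => (Finset.mem_inter.1 (hI hx)).1
  have hIB : I ⊆ B := fun x hx => (Finset.mem_inter.1 (hI hx)).2
  have e1 : A ∩ ((U \ A) ∪ I) = I := by
    ext x; have := @hIA x; simp only [Finset.mem_inter, Finset.mem_union, Finset.mem_sdiff]; tauto
  have e2 : ((U \ B) ∪ I) ∩ B = I := by
    ext x; have := @hIB x; simp only [Finset.mem_inter, Finset.mem_union, Finset.mem_sdiff]; tauto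
  have e3 : A ∪ ((U \ A) ∪ I) = U := by
    ext x; have := @hIA x; have := @hAU x
    simp only [Finset.mem_union, Finset.mem_sdiff]; tauto
  have e4 : ((U \ B) ∪ I) ∪ B = U := by
    ext x; have := @hIB x; have := @hBU x
    simp only [Finset.mem_union, Finset.mem_sdiff]; tauto
  have c1 := Finset.card_union_add_card_inter A ((U \ A) ∪ I)
  have c2 := Finset.card_union_add_card_inter ((U \ B) ∪ I) B
  rw [e3, e1] at c1
  rw [e4, e2] at c2
  refine ⟨(U \ B) ∪ I, (U \ A) ∪ I, ?_, ?_, by omega, by omega, by rw [e1, hIc],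
    by rw [e2, hIc], by rw [e1, e2, e3, e4]⟩
  · intro hh
    rw [hh] at e2
    rw [e2] at h
    omega
  · intro hh
    rw [hh] at e1
    rw [e1] at h
    omega

theorem aux_count (H r b i : ℕ) (hib : i ≤ b) (A : Finset (Fin H)) (hA : A.card = r) :
    (Finset.univ.filter (fun B : Finset (Fin H) => B.card = b ∧ (A ∩ B).card = i)).card
      = Nat.choose r i * Nat.choose (H - r) (b - i) := by
  have hc : (Aᶜ).card = H - r := by rw [Finset.card_compl, Fintype.card_fin, hA]
  rw [← hA, ← Finset.card_powersetCard, hA, ← hc, ← Finset.card_powersetCard,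
    ← Finset.card_product]
  refine Finset.card_bij' (fun B _ => (A ∩ B, B \ A)) (fun p _ => p.1 ∪ p.2) ?_ ?_ ?_ ?_
  · intro B hB
    simp only [Finset.mem_filter, Finset.mem_univ, true_and] at hB
    have h1 := Finset.card_inter_add_card_sdiff B A
    rw [Finset.inter_comm] at h1
    simp only [Finset.mem_product, Finset.mem_powersetCard]
    refine ⟨⟨Finset.inter_subset_left, hB.2⟩, ?_, by omega⟩
    intro x; simp
  · rintro ⟨S, T⟩ hp
    simp only [Finset.mem_product, Finset.mem_powersetCard] at hp
    obtain ⟨⟨hS, hSc⟩, hT, hTc⟩ := hp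
    have hd : Disjoint S T := by
      rw [Finset.disjoint_left]
      intro x hx hx'
      exact Finset.mem_compl.1 (hT hx') (hS hx)
    have e : A ∩ (S ∪ T) = S := by
      ext x
      have h1 := @hS x
      have h2 := @hT x
      simp only [Finset.mem_inter, Finset.mem_union, Finset.mem_compl] at *
      tauto
    simp only [Finset.mem_filter, Finset.mem_univ, true_and]
    rw [e, Finset.card_union_of_disjoint hd]
    omega
  · intro B _
    ext x
    simp only [Finset.mem_inter, Finset.mem_union, Finset.mem_sdiff]
    tauto
  · rintro ⟨S, T⟩ hp
    simp only [Finset.mem_product, Finset.mem_powersetCard] at hp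
    obtain ⟨⟨hS, hSc⟩, hT, hTc⟩ := hp
    refine Prod.ext ?_ ?_ <;>
    · ext x
      have h1 := @hS x
      have h2 := @hT x
      simp only [Finset.mem_inter, Finset.mem_union, Finset.mem_compl, Finset.mem_sdiff] at *
      tauto

/-- In the array `P`, for every fixed column `A` (an `r`-subset of `[0,H)`),
the number of rows `B` (`b`-subsets of `[0,H)`) such that `p_{B,A} = *` is a useless star
equals `Σ_{i=0}^{λ−1} C(r,i)·C(H−r, b−i)`; equivalently, the useless stars in column `A`
are exactly the entries `p_{B,A}` with `|A∩B| < λ`. -/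
theorem stmt_13 (H r b l : ℕ) (hH : 0 < H) (hr : 0 < r) (hb : 0 < b) (hl : 0 < l)
    (hrH : r < H) (hbH : b < H) (hlr : l < r) (hlb : l < b) (hrb : r + b ≤ H)
    (A : Finset (Fin H)) (hA : A.card = r) :
    {B : Finset (Fin H) | B.card = b ∧ (A ∩ B).card ≠ l ∧ ¬ UsefulStarP H r b l B A}.ncard
      = ∑ i ∈ Finset.range l, Nat.choose r i * Nat.choose (H - r) (b - i) ∧
    ∀ B : Finset (Fin H), B.card = b →
      (((A ∩ B).card ≠ l ∧ ¬ UsefulStarP H r b l B A) ↔ (A ∩ B).card < l) := by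
  have key : ∀ B : Finset (Fin H), B.card = b →
      (((A ∩ B).card ≠ l ∧ ¬ UsefulStarP H r b l B A) ↔ (A ∩ B).card < l) := by
    intro B hB
    constructor
    · rintro ⟨h1, h2⟩
      by_contra h3
      exact h2 (aux_useful H r b l hrb A B hA hB (by omega))
    · intro h
      refine ⟨h.ne, ?_⟩
      rintro ⟨A', B', _, _, _, _, h1, h2, h3⟩
      have h4 : A ∩ B' = A' ∩ B := (Prod.ext_iff.1 h3).2
      have h5 : A ∩ B' ⊆ A ∩ B := by
        intro x hx
        have hx' := hx
        rw [h4] at hx'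
        exact Finset.mem_inter.2 ⟨(Finset.mem_inter.1 hx).1, (Finset.mem_inter.1 hx').2⟩
      have := Finset.card_le_card h5
      omega
  refine ⟨?_, key⟩
  have hs : {B : Finset (Fin H) | B.card = b ∧ (A ∩ B).card ≠ l ∧ ¬ UsefulStarP H r b l B A}
      = ↑(Finset.univ.filter (fun B : Finset (Fin H) => B.card = b ∧ (A ∩ B).card < l)) := by
    ext B
    simp only [Set.mem_setOf_eq, Finset.coe_filter, Finset.mem_univ, true_and]
    exact and_congr_right (key B)
  rw [hs, Set.ncard_coe_finset,
    Finset.card_eq_sum_card_fiberwise (f := fun B => (A ∩ B).card) (t := Finset.range l)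
      (by intro B hB; simpa using (Finset.mem_filter.1 hB).2.2)]
  refine Finset.sum_congr rfl fun i hi => ?_
  rw [Finset.mem_range] at hi
  rw [← aux_count H r b i (by omega) A hA, Finset.filter_filter]
  congr 1
  ext B
  simp only [Finset.mem_filter, Finset.mem_univ, true_and]
  constructor
  · rintro ⟨⟨h1, _⟩, h2⟩
    exact ⟨h1, h2⟩
  · rintro ⟨h1, h2⟩
    exact ⟨⟨h1, by omega⟩, h2⟩
end

section
/- Let H, r, b, λ be positive integers with 0 < r, b < H, λ < min(r,b) and r + b ≤ H + λ. Let A be an r-subset and B a b-subset of [0,H) with |A∩B| > λ. Then there do not exist an r-subset A' and a b-subset B' of [0,H) such that |A∩B'| = λ, |A'∩B| = λ, (A∪B')\(A∩B') = (A'∪B)\(A'∩B), and A\B' = A'\B. (Hence the star entry p'_{B,A} of the array P' is useless: it never occurs as a cross entry of two equal-label entries of P'.) -/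
/-- If `|A∩B| > λ` (so `p'_{B,A} = *` in the array `P'` with labels
`((A∪B)\(A∩B), A\B)`), then there is no pair of entries `p'_{B',A}` and `p'_{B,A'}` carrying
the same non-star label; hence the star `p'_{B,A}` is useless. -/
theorem stmt_14 (H r b l : ℕ) (hH : 0 < H) (hr : 0 < r) (hb : 0 < b) (hl : 0 < l)
    (hrH : r < H) (hbH : b < H) (hlr : l < r) (hlb : l < b) (hrb : r + b ≤ H + l)
    (A B : Finset (Fin H)) (hA : A.card = r) (hB : B.card = b) (hAB : l < (A ∩ B).card) :
    ¬ ∃ A' B' : Finset (Fin H), A'.card = r ∧ B'.card = b ∧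
      (A ∩ B').card = l ∧ (A' ∩ B).card = l ∧
      (A ∪ B') \ (A ∩ B') = (A' ∪ B) \ (A' ∩ B) ∧ A \ B' = A' \ B := by
  rintro ⟨A', B', -, -, h1, -, -, h2⟩
  have hsub : A ∩ B ⊆ A ∩ B' := by
    intro x hx
    rw [Finset.mem_inter] at hx ⊢
    refine ⟨hx.1, ?_⟩
    by_contra hxB
    have h3 : x ∈ A \ B' := Finset.mem_sdiff.mpr ⟨hx.1, hxB⟩
    rw [h2] at h3
    exact (Finset.mem_sdiff.mp h3).2 hx.2
  have := Finset.card_le_card hsub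
  omega
end

section
/- Let H, r, b, λ be positive integers with 0 < r, b < H, λ < min(r,b) and r + b ≤ H + λ. Let A be an r-subset and B a b-subset of [0,H) with |A∩B| < λ. Then there exist an r-subset A' ≠ A and a b-subset B' ≠ B of [0,H) such that |A∩B'| = λ, |A'∩B| = λ, A\B' = A'\B, and (A∪B')\(A∩B') = (A'∪B)\(A'∩B). (Hence the star entry p'_{B,A} of the array P' is useful.) -/
/-- If `|A∩B| < λ` (so `p'_{B,A} = *` in the array `P'` with labels
`((A∪B)\(A∩B), A\B)`), then there exist entries `p'_{B',A}` and `p'_{B,A'}` (with `A' ≠ A`,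
`B' ≠ B`) carrying the same non-star label; hence the star `p'_{B,A}` is useful. -/
theorem stmt_15 (H r b l : ℕ) (hH : 0 < H) (hr : 0 < r) (hb : 0 < b) (hl : 0 < l)
    (hrH : r < H) (hbH : b < H) (hlr : l < r) (hlb : l < b) (hrb : r + b ≤ H + l)
    (A B : Finset (Fin H)) (hA : A.card = r) (hB : B.card = b) (hAB : (A ∩ B).card < l) :
    ∃ A' B' : Finset (Fin H), A' ≠ A ∧ B' ≠ B ∧ A'.card = r ∧ B'.card = b ∧
      (A ∩ B').card = l ∧ (A' ∩ B).card = l ∧ A \ B' = A' \ B ∧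
      (A ∪ B') \ (A ∩ B') = (A' ∪ B) \ (A' ∩ B) := by
  have h1 := Finset.card_sdiff_add_card_inter A B
  have h2 := Finset.card_sdiff_add_card_inter B A
  rw [Finset.inter_comm B A] at h2
  obtain ⟨X, hX, hXc⟩ := Finset.exists_subset_card_eq (s := A \ B) (n := r - l) (by omega)
  obtain ⟨Y, hY, hYc⟩ := Finset.exists_subset_card_eq (s := B \ A) (n := b - l) (by omega)
  have hX1 : ∀ x ∈ X, x ∈ A ∧ x ∉ B := fun x hx => Finset.mem_sdiff.1 (hX hx)
  have hY1 : ∀ x ∈ Y, x ∈ B ∧ x ∉ A := fun x hx => Finset.mem_sdiff.1 (hY hx)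
  have cAX : (A \ X).card = l := by
    rw [Finset.card_sdiff_of_subset (fun x hx => (hX1 x hx).1)]; omega
  have cBY : (B \ Y).card = l := by
    rw [Finset.card_sdiff_of_subset (fun x hx => (hY1 x hx).1)]; omega
  have e1 : A ∩ ((A \ X) ∪ Y) = A \ X := by
    ext x; have := hX1 x; have := hY1 x
    simp only [Finset.mem_inter, Finset.mem_union, Finset.mem_sdiff]; tauto
  have e2 : ((B \ Y) ∪ X) ∩ B = B \ Y := by
    ext x; have := hX1 x; have := hY1 x
    simp only [Finset.mem_inter, Finset.mem_union, Finset.mem_sdiff]; tauto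
  refine ⟨(B \ Y) ∪ X, (A \ X) ∪ Y, ?_, ?_, ?_, ?_, ?_, ?_, ?_, ?_⟩
  · intro h
    rw [h] at e2
    rw [e2] at hAB; omega
  · intro h
    rw [h] at e1
    rw [e1] at hAB; omega
  · rw [Finset.card_union_of_disjoint, cBY, hXc]
    · omega
    · rw [Finset.disjoint_left]; intro x hx hx'
      exact (hX1 x hx').2 (Finset.mem_sdiff.1 hx).1
  · rw [Finset.card_union_of_disjoint, cAX, hYc]
    · omega
    · rw [Finset.disjoint_left]; intro x hx hx'
      exact (hY1 x hx').2 (Finset.mem_sdiff.1 hx).1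
  · rw [e1, cAX]
  · rw [e2, cBY]
  · ext x; have := hX1 x; have := hY1 x
    simp only [Finset.mem_union, Finset.mem_sdiff]; tauto
  · ext x; have := hX1 x; have := hY1 x
    simp only [Finset.mem_inter, Finset.mem_union, Finset.mem_sdiff]
    by_cases ha : x ∈ A <;> by_cases hb' : x ∈ B <;> by_cases hx : x ∈ X <;>
      by_cases hy : x ∈ Y <;> simp_all
end
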